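/- arXiv:1112.0950 — 4 statements merged into one kernel-verified Lean document; each statement's English description precedes it below -/
import Mathlib

section
/- Let n ≥ 1 and let f : (Fin n → Bool) → (Fin n → Bool) be any function. Define the asynchronous update F_f(i, x) = Function.update x i (f x i) for i : Fin n and x : Fin n → Bool, and define G_f on X = (ℕ → Fin n) × (Fin n → Bool) by G_f (S, x) = (fun t => S (t+1), F_f (S 0, x)). Equip X with the product topology, where Fin n → Bool carries the discrete topology and ℕ → Fin n carries the product of discrete topologies. Then G_f is chaotic in the sense of Devaney (i.e., G_f is topologically transitive and its set of periodic points is dense in X) if and only if the iteration graph Γ(f) is strongly connected, i.e., for all configurations x, y : Fin n → Bool, y is reachable from x under the reflexive-transitive closure of the relation a ⟶ b ↔ ∃ i : Fin n, b = Function.update a i (f a i). -/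
/-- One-step relation of the iteration graph Γ(f): an arc from `a` to
`Function.update a i (f a i)` for each `i`. -/
def IterStep (n : ℕ) (f : (Fin n → Bool) → (Fin n → Bool))
    (a b : Fin n → Bool) : Prop :=
  ∃ i : Fin n, b = Function.update a i (f a i)

/-- The chaotic-iterations map `G_f` on `X = (ℕ → Fin n) × (Fin n → Bool)`. -/
def Gmap (n : ℕ) (f : (Fin n → Bool) → (Fin n → Bool))
    (P : (ℕ → Fin n) × (Fin n → Bool)) : (ℕ → Fin n) × (Fin n → Bool) :=
  (fun t => P.1 (t + 1), Function.update P.2 (P.1 0) (f P.2 (P.1 0)))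

/-- The sequence that follows `S` for `m` terms and then continues with `T`. -/
def splice {α : Type*} (m : ℕ) (S T : ℕ → α) (t : ℕ) : α :=
  if t < m then S t else T (t - m)

theorem Gmap_iterate_splice {n : ℕ} (f : (Fin n → Bool) → (Fin n → Bool)) (m : ℕ)
    (S T : ℕ → Fin n) (x : Fin n → Bool) :
    (Gmap n f)^[m] (splice m S T, x) = (T, ((Gmap n f)^[m] (S, x)).2) := by
  induction m generalizing S x with
  | zero => rfl
  | succ m ih =>
    have h : Gmap n f (splice (m + 1) S T, x) =
        (splice m (fun t => S (t + 1)) T, Function.update x (S 0) (f x (S 0))) := by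
      simp [Gmap, splice, funext_iff]
    rw [Function.iterate_succ_apply, Function.iterate_succ_apply, h, ih]
    rfl

theorem reflTransGen_iterStep_iterate {n : ℕ} (f : (Fin n → Bool) → (Fin n → Bool)) (k : ℕ)
    (P : (ℕ → Fin n) × (Fin n → Bool)) :
    Relation.ReflTransGen (IterStep n f) P.2 ((Gmap n f)^[k] P).2 := by
  induction k with
  | zero => exact .refl
  | succ k ih =>
    rw [Function.iterate_succ_apply']
    exact ih.tail ⟨_, rfl⟩

theorem exists_Gmap_iterate_eq {n : ℕ} {f : (Fin n → Bool) → (Fin n → Bool)}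
    {x y : Fin n → Bool} (h : Relation.ReflTransGen (IterStep n f) x y) (T : ℕ → Fin n) :
    ∃ (k : ℕ) (S : ℕ → Fin n), (Gmap n f)^[k] (S, x) = (T, y) := by
  induction h using Relation.ReflTransGen.head_induction_on with
  | refl => exact ⟨0, T, rfl⟩
  | head hab _ ih =>
    obtain ⟨i, rfl⟩ := hab
    obtain ⟨k, S, hS⟩ := ih
    refine ⟨k + 1, fun t => Nat.casesOn t i S, ?_⟩
    rw [Function.iterate_succ_apply]
    exact hS

theorem IsOpen.exists_forall_lt_eq_imp_mem {α β : Type*} [TopologicalSpace α]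
    [TopologicalSpace β] {U : Set ((ℕ → α) × β)} (hU : IsOpen U) {S : ℕ → α} {x : β}
    (h : (S, x) ∈ U) : ∃ m : ℕ, ∀ S' : ℕ → α, (∀ t < m, S' t = S t) → (S', x) ∈ U := by
  have hV : IsOpen ((fun S' : ℕ → α => (S', x)) ⁻¹' U) := hU.preimage (by fun_prop)
  obtain ⟨I, u, hu, hsub⟩ := isOpen_pi_iff.1 hV S h
  refine ⟨I.sup id + 1, fun S' hS' => hsub fun t ht => ?_⟩
  rw [hS' t (Nat.lt_succ_of_le (Finset.le_sup (f := id) ht))]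
  exact (hu t ht).2

theorem exists_Gmap_iterate_mem {n : ℕ} {f : (Fin n → Bool) → (Fin n → Bool)}
    (h : ∀ x y : Fin n → Bool, Relation.ReflTransGen (IterStep n f) x y)
    {U : Set ((ℕ → Fin n) × (Fin n → Bool))} (hU : IsOpen U) (hne : U.Nonempty)
    (Q : (ℕ → Fin n) × (Fin n → Bool)) : ∃ k : ℕ, Q ∈ (Gmap n f)^[k] '' U := by
  obtain ⟨⟨S, x⟩, hSx⟩ := hne
  obtain ⟨m, hm⟩ := hU.exists_forall_lt_eq_imp_mem hSx
  obtain ⟨k, W, hW⟩ := exists_Gmap_iterate_eq (h ((Gmap n f)^[m] (S, x)).2 Q.2) Q.1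
  refine ⟨k + m, (splice m S W, x), hm _ fun t ht => if_pos ht, ?_⟩
  rw [Function.iterate_add_apply, Gmap_iterate_splice, hW]

theorem exists_Gmap_periodic_mem {n : ℕ} {f : (Fin n → Bool) → (Fin n → Bool)}
    (h : ∀ x y : Fin n → Bool, Relation.ReflTransGen (IterStep n f) x y)
    {U : Set ((ℕ → Fin n) × (Fin n → Bool))} (hU : IsOpen U) (hne : U.Nonempty) :
    ∃ P ∈ U, ∃ k > 0, (Gmap n f)^[k] P = P := by
  obtain ⟨⟨S, x⟩, hSx⟩ := hne
  obtain ⟨m, hm⟩ := hU.exists_forall_lt_eq_imp_mem hSx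
  obtain ⟨k, W, hW⟩ := exists_Gmap_iterate_eq (h ((Gmap n f)^[m + 1] (S, x)).2 x) S
  have hloop : ((Gmap n f)^[k + (m + 1)] (splice (m + 1) S W, x)).2 = x := by
    rw [Function.iterate_add_apply, Gmap_iterate_splice, hW]
  let R : ℕ → Fin n := fun t => splice (m + 1) S W (t % (k + (m + 1)))
  have hR : splice (k + (m + 1)) (splice (m + 1) S W) R = R := by
    funext t
    by_cases ht : t < k + (m + 1)
    · simp only [splice, R, if_pos ht, Nat.mod_eq_of_lt ht]
    · simp only [splice, R, if_neg ht, ← Nat.mod_eq_sub_mod (not_lt.1 ht)]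
  refine ⟨(R, x), hm _ fun t ht => ?_, k + (m + 1), by omega, ?_⟩
  · have h1 : t < k + (m + 1) := by omega
    have h2 : t < m + 1 := by omega
    simp only [R, splice, Nat.mod_eq_of_lt h1, if_pos h2]
  · have hper := Gmap_iterate_splice f (k + (m + 1)) (splice (m + 1) S W) R x
    rwa [hR, hloop] at hper

/-- `G_f` is chaotic in the sense of Devaney (topologically transitive with a
dense set of periodic points, for the product topology on
`(ℕ → Fin n) × (Fin n → Bool)` with `Fin n` and `Bool` discrete) if and only if
the iteration graph `Γ(f)` is strongly connected. -/
theorem devaney_chaos_iff_strongly_connected (n : ℕ) (hn : 1 ≤ n)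
    (f : (Fin n → Bool) → (Fin n → Bool)) :
    ((∀ U V : Set ((ℕ → Fin n) × (Fin n → Bool)),
        IsOpen U → IsOpen V → U.Nonempty → V.Nonempty →
          ∃ k : ℕ, (((Gmap n f)^[k]) '' U ∩ V).Nonempty) ∧
      Dense {P : (ℕ → Fin n) × (Fin n → Bool) | ∃ k > 0, (Gmap n f)^[k] P = P})
    ↔ ∀ x y : Fin n → Bool, Relation.ReflTransGen (IterStep n f) x y := by
  constructor
  · rintro ⟨htrans, -⟩ x y
    have hopen (z : Fin n → Bool) : IsOpen {P : (ℕ → Fin n) × (Fin n → Bool) | P.2 = z} :=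
      (isOpen_discrete {z}).preimage continuous_snd
    have hne (z : Fin n → Bool) : {P : (ℕ → Fin n) × (Fin n → Bool) | P.2 = z}.Nonempty :=
      ⟨(fun _ => ⟨0, hn⟩, z), rfl⟩
    obtain ⟨k, _, ⟨P, rfl, rfl⟩, rfl⟩ := htrans _ _ (hopen x) (hopen y) (hne x) (hne y)
    exact reflTransGen_iterStep_iterate f k P
  · intro h
    refine ⟨fun U V hU _ hUne ⟨Q, hQ⟩ => ?_, dense_iff_inter_open.2 fun U hU hne => ?_⟩
    · obtain ⟨k, hk⟩ := exists_Gmap_iterate_mem h hU hUne Q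
      exact ⟨k, Q, hk, hQ⟩
    · exact exists_Gmap_periodic_mem h hU hne
end

section
/- Let n ≥ 1 and f : (Fin n → Bool) → (Fin n → Bool). If the iteration graph Γ(f) is strongly connected (for all x, y : Fin n → Bool, y is reachable from x under the reflexive-transitive closure of a ⟶ b ↔ ∃ i : Fin n, b = Function.update a i (f a i)), then the set of periodic points of G_f (S, x) = (fun t => S (t+1), Function.update x (S 0) (f x (S 0))) is dense in X = (ℕ → Fin n) × (Fin n → Bool) with the product topology (Fin n and Bool discrete): the set {P : X | ∃ k > 0, G_f^[k] P = P} is dense. -/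
theorem Gmap_iterate_fst (n : ℕ) (f : (Fin n → Bool) → (Fin n → Bool)) (k : ℕ)
    (P : (ℕ → Fin n) × (Fin n → Bool)) (t : ℕ) :
    ((Gmap n f)^[k] P).1 t = P.1 (t + k) := by
  induction k generalizing P with
  | zero => rfl
  | succ k ih =>
    rw [Function.iterate_succ_apply, ih]
    simp [Gmap, add_assoc]

/-- The configuration after `k` iterations depends only on the first `k` terms of the strategy. -/
theorem Gmap_iterate_snd_congr (n : ℕ) (f : (Fin n → Bool) → (Fin n → Bool)) (k : ℕ)
    (P Q : (ℕ → Fin n) × (Fin n → Bool)) (hfst : ∀ t < k, P.1 t = Q.1 t) (hsnd : P.2 = Q.2) :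
    ((Gmap n f)^[k] P).2 = ((Gmap n f)^[k] Q).2 := by
  induction k generalizing P Q with
  | zero => exact hsnd
  | succ k ih =>
    rw [Function.iterate_succ_apply, Function.iterate_succ_apply]
    apply ih
    · intro t ht
      exact hfst (t + 1) (by lia)
    · simp [Gmap, hsnd, hfst 0 (by lia)]

theorem exists_Gmap_iterate_snd_eq (n : ℕ) (hn : 1 ≤ n) (f : (Fin n → Bool) → (Fin n → Bool))
    {x y : Fin n → Bool} (h : Relation.ReflTransGen (IterStep n f) x y) :
    ∃ (k : ℕ) (S : ℕ → Fin n), ((Gmap n f)^[k] (S, x)).2 = y := by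
  induction h using Relation.ReflTransGen.head_induction_on with
  | refl => exact ⟨0, fun _ => ⟨0, hn⟩, rfl⟩
  | head hstep _ ih =>
    obtain ⟨i, rfl⟩ := hstep
    obtain ⟨k, S, hS⟩ := ih
    refine ⟨k + 1, fun t => t.casesOn i S, ?_⟩
    rw [Function.iterate_succ_apply]
    exact hS

/-- Every finite strategy prefix extends to a periodic point with the same configuration. -/
theorem exists_periodic_of_strategy_prefix (n : ℕ) (hn : 1 ≤ n)
    (f : (Fin n → Bool) → (Fin n → Bool))
    (hsc : ∀ x y : Fin n → Bool, Relation.ReflTransGen (IterStep n f) x y)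
    (S : ℕ → Fin n) (x : Fin n → Bool) (m : ℕ) (hm : 0 < m) :
    ∃ W : ℕ → Fin n, (∀ t < m, W t = S t) ∧ ∃ k > 0, (Gmap n f)^[k] (W, x) = (W, x) := by
  obtain ⟨k, T, hT⟩ := exists_Gmap_iterate_snd_eq n hn f (hsc ((Gmap n f)^[m] (S, x)).2 x)
  let W : ℕ → Fin n := fun t =>
    if t % (k + m) < m then S (t % (k + m)) else T (t % (k + m) - m)
  have hWS : ∀ t < m, W t = S t := by
    intro t ht
    simp [W, Nat.mod_eq_of_lt (show t < k + m by lia), ht]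
  have hWT : ∀ t < k, W (t + m) = T t := by
    intro t ht
    simp [W, Nat.mod_eq_of_lt (show t + m < k + m by lia)]
  refine ⟨W, hWS, k + m, by lia, Prod.ext (funext fun t => ?_) ?_⟩
  · rw [Gmap_iterate_fst]
    simp [W]
  · rw [Function.iterate_add_apply]
    refine Eq.trans (Gmap_iterate_snd_congr n f k _ (T, _) (fun t ht => ?_) ?_) hT
    · rw [Gmap_iterate_fst]
      exact hWT t ht
    · exact Gmap_iterate_snd_congr n f m _ _ hWS rfl

/-- If the iteration graph `Γ(f)` is strongly connected, then the set of
periodic points of `G_f` is dense in `(ℕ → Fin n) × (Fin n → Bool)` with the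
product topology (`Fin n` and `Bool` discrete). -/
theorem dense_periodic_of_strongly_connected (n : ℕ) (hn : 1 ≤ n)
    (f : (Fin n → Bool) → (Fin n → Bool))
    (hsc : ∀ x y : Fin n → Bool, Relation.ReflTransGen (IterStep n f) x y) :
    Dense {P : (ℕ → Fin n) × (Fin n → Bool) | ∃ k > 0, (Gmap n f)^[k] P = P} := by
  rintro ⟨S, x⟩
  choose W hWS hWper using fun m : ℕ =>
    exists_periodic_of_strategy_prefix n hn f hsc S x (m + 1) m.succ_pos
  have hlim : Filter.Tendsto W Filter.atTop (nhds S) := by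
    refine tendsto_pi_nhds.2 fun t => tendsto_nhds_of_eventually_eq ?_
    filter_upwards [Filter.eventually_ge_atTop t] with m hm
    exact hWS m t (by lia)
  exact mem_closure_of_tendsto (hlim.prodMk_nhds tendsto_const_nhds)
    (Filter.Eventually.of_forall hWper)
end

section
/- Let n ≥ 1 and f : (Fin n → Bool) → (Fin n → Bool). If the map G_f (S, x) = (fun t => S (t+1), Function.update x (S 0) (f x (S 0))) on X = (ℕ → Fin n) × (Fin n → Bool), with the product topology (Fin n and Bool discrete), is topologically transitive (for all nonempty open U, V ⊆ X there exists k : ℕ with (G_f^[k]) '' U ∩ V ≠ ∅), then the iteration graph Γ(f) is strongly connected: for all x, y : Fin n → Bool, y is reachable from x under the reflexive-transitive closure of the relation a ⟶ b ↔ ∃ i : Fin n, b = Function.update a i (f a i). -/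
theorem iterStep_snd_gmap (n : ℕ) (f : (Fin n → Bool) → (Fin n → Bool))
    (P : (ℕ → Fin n) × (Fin n → Bool)) : IterStep n f P.2 (Gmap n f P).2 :=
  ⟨P.1 0, rfl⟩

theorem reflTransGen_snd_iterate_gmap (n : ℕ) (f : (Fin n → Bool) → (Fin n → Bool))
    (k : ℕ) (P : (ℕ → Fin n) × (Fin n → Bool)) :
    Relation.ReflTransGen (IterStep n f) P.2 ((Gmap n f)^[k] P).2 := by
  induction k with
  | zero => exact .refl
  | succ k ih =>
    rw [Function.iterate_succ_apply']
    exact ih.tail (iterStep_snd_gmap n f _)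

/-- If `G_f` is topologically transitive on `(ℕ → Fin n) × (Fin n → Bool)`
with the product topology (`Fin n` and `Bool` discrete), then the iteration
graph `Γ(f)` is strongly connected. -/
theorem strongly_connected_of_transitive (n : ℕ) (hn : 1 ≤ n)
    (f : (Fin n → Bool) → (Fin n → Bool))
    (htrans : ∀ U V : Set ((ℕ → Fin n) × (Fin n → Bool)),
      IsOpen U → IsOpen V → U.Nonempty → V.Nonempty →
        ∃ k : ℕ, (((Gmap n f)^[k]) '' U ∩ V).Nonempty) :
    ∀ x y : Fin n → Bool, Relation.ReflTransGen (IterStep n f) x y := by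
  intro x y
  have isOpen_fiber (z : Fin n → Bool) :
      IsOpen (Prod.snd ⁻¹' {z} : Set ((ℕ → Fin n) × (Fin n → Bool))) :=
    (isOpen_discrete {z}).preimage continuous_snd
  have fiber_nonempty (z : Fin n → Bool) :
      (Prod.snd ⁻¹' {z} : Set ((ℕ → Fin n) × (Fin n → Bool))).Nonempty :=
    ⟨(fun _ => ⟨0, hn⟩, z), rfl⟩
  obtain ⟨k, _, ⟨P, rfl, rfl⟩, rfl⟩ :=
    htrans _ _ (isOpen_fiber x) (isOpen_fiber y) (fiber_nonempty x) (fiber_nonempty y)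
  exact reflTransGen_snd_iterate_gmap n f k P
end

section
/- Let f : (Fin 4 → Bool) → (Fin 4 → Bool) be the function encoded by the list [14,15,13,12,11,10,9,8,7,6,5,4,3,2,1,0], i.e., f agrees with the vectorial negation neg x = fun i => !(x i) on all configurations except that f maps the configuration encoding 0 (all bits false) to the configuration encoding 14 and the configuration encoding 1 to the configuration encoding 15 (configurations k ∈ ⟦0,15⟧ are identified with their 4-bit binary expansions). Then the iteration graph Γ(f) is strongly connected: for all x, y : Fin 4 → Bool, y is reachable from x under the reflexive-transitive closure of the relation a ⟶ b ↔ ∃ i : Fin 4, b = Function.update a i (f a i). -/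
/-- The configuration of `Fin 4 → Bool` encoding the integer `k` via its
4-bit binary expansion (bit `i` is the coefficient of `2 ^ i`). -/
def decode4 (k : ℕ) : Fin 4 → Bool := fun i => k.testBit (i : ℕ)

/-- For the function `f` on `Bool⁴` encoded by the list
`[14,15,13,12,11,10,9,8,7,6,5,4,3,2,1,0]` (the vectorial negation everywhere
except that `0 ↦ 14` and `1 ↦ 15`), the iteration graph `Γ(f)` is strongly
connected. -/
theorem generator_b_graph_strongly_connected
    (f : (Fin 4 → Bool) → (Fin 4 → Bool))
    (h0 : f (decode4 0) = decode4 14)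
    (h1 : f (decode4 1) = decode4 15)
    (hrest : ∀ x : Fin 4 → Bool, x ≠ decode4 0 → x ≠ decode4 1 →
      f x = fun i => !(x i)) :
    ∀ x y : Fin 4 → Bool,
      Relation.ReflTransGen
        (fun a b : Fin 4 → Bool => ∃ i : Fin 4, b = Function.update a i (f a i))
        x y := by
  have flip : ∀ (x : Fin 4 → Bool) (i : Fin 4), i ≠ 0 ∨ x 1 = true → f x i = !(x i) := by
    intro x i hi
    by_cases hx0 : x = decode4 0
    · subst hx0
      rw [h0]
      revert i
      decide
    by_cases hx1 : x = decode4 1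
    · subst hx1
      rw [h1]
      revert i
      decide
    rw [hrest x hx0 hx1]
  have set_bit : ∀ (x : Fin 4 → Bool) (i : Fin 4) (b : Bool), i ≠ 0 ∨ x 1 = true →
      Relation.ReflTransGen
        (fun a b : Fin 4 → Bool => ∃ i : Fin 4, b = Function.update a i (f a i))
        x (Function.update x i b) := by
    intro x i b hi
    by_cases hb : b = x i
    · rw [hb, Function.update_eq_self]
    · refine .single ⟨i, ?_⟩
      rw [flip x i hi, Bool.eq_not_of_ne hb]
  intro x y
  -- Raise bit 1, which frees bit 0; set bit 0, and then the remaining bits.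
  have path := (((set_bit x 1 true (.inl (by decide))).trans
    (set_bit _ 0 (y 0) (by simp))).trans
    (set_bit _ 1 (y 1) (.inl (by decide)))).trans
    ((set_bit _ 2 (y 2) (.inl (by decide))).trans (set_bit _ 3 (y 3) (.inl (by decide))))
  convert path using 1
  funext i
  fin_cases i <;> simp
end
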